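/- Let k be an algebraically closed field and let n, r be natural numbers with n ≥ r + 2. Let J be a homogeneous ideal of the polynomial ring k[X₀,…,X_n] such that the Krull dimension of k[X₀,…,X_n]/J is r + 1, and let Z ⊆ k^{n+1} be the affine cone of common zeros of J (so Z corresponds to a closed subvariety X of ℙⁿ(k) of dimension r). Then there exist |k|-many distinct lines in ℙⁿ(k) disjoint from X; that is, there is an injective map from k to the set of 2-dimensional k-linear subspaces W of k^{n+1} with W ∩ Z = {0}. -/

import Mathlib

universe u

attribute [local instance] MvPolynomial.gradedAlgebra

/-- Krull's dimension drop: if `f` lies in no non-maximal minimal prime of `I`, then adjoining `f`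
to `I` lowers the dimension of the zero locus, provided that dimension is positive. -/
theorem krullDim_zeroLocus_sup_span_singleton_le {R : Type*} [CommRing R] (I : Ideal R) (f : R)
    (d : ℕ) (hf : ∀ p ∈ I.minimalPrimes, ¬ p.IsMaximal → f ∉ p)
    (hI : Order.krullDim (PrimeSpectrum.zeroLocus (I : Set R)) ≤ (d + 1 : ℕ)) :
    Order.krullDim (PrimeSpectrum.zeroLocus ((I ⊔ Ideal.span {f} : Ideal R) : Set R)) ≤ d := by
  refine iSup_le fun c => ?_
  have hle : I ⊔ Ideal.span {f} ≤ c.head.1.asIdeal := c.head.2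
  have hfc : f ∈ c.head.1.asIdeal :=
    hle (Ideal.mem_sup_right (Ideal.mem_span_singleton_self f))
  obtain ⟨q, hq, hqc⟩ := Ideal.exists_minimalPrimes_le (le_sup_left.trans hle)
  by_cases hmax : q.IsMaximal
  · have hlen : c.length = 0 := by
      by_contra h
      have hlt : c.head < c.last := LTSeries.strictMono c (Fin.lt_last_iff_ne_last.2 (by
        simpa [Fin.ext_iff, eq_comm] using h))
      have hlt' : c.head.1.asIdeal < c.last.1.asIdeal := hlt
      exact c.last.1.isPrime.ne_top (hmax.1.2 _ (hqc.trans_lt hlt'))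
    simp [hlen]
  · have hsub : PrimeSpectrum.zeroLocus ((I ⊔ Ideal.span {f} : Ideal R) : Set R) ⊆
        PrimeSpectrum.zeroLocus (I : Set R) :=
      PrimeSpectrum.zeroLocus_anti_mono_ideal le_sup_left
    let c' : LTSeries (PrimeSpectrum.zeroLocus (I : Set R)) :=
      c.map (Set.inclusion hsub) fun _ _ h => h
    have hqlt : q < c.head.1.asIdeal := lt_of_le_of_ne hqc fun h => hf q hq hmax (h ▸ hfc)
    let c'' : LTSeries (PrimeSpectrum.zeroLocus (I : Set R)) :=
      RelSeries.cons c' ⟨⟨q, hq.1.1⟩, hq.1.2⟩ hqlt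
    have hlen := (Order.LTSeries.length_le_krullDim c'').trans hI
    rw [show c''.length = c.length + 1 from RelSeries.cons_length _ _ _] at hlen
    have h : c.length + 1 ≤ d + 1 := by exact_mod_cast hlen
    exact_mod_cast Nat.le_of_succ_le_succ h

section Pencil

variable {k E : Type*} [Field k] [AddCommGroup E] [Module k E]

theorem exists_notMem_of_top_notMem [Infinite k] (F : Finset (Submodule k E)) (hF : ⊤ ∉ F) :
    ∃ x : E, ∀ L ∈ F, x ∉ L := by
  by_contra! h
  refine Subspace.biUnion_ne_univ_of_top_notMem hF (Set.eq_univ_of_forall fun x => ?_)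
  simpa using h x

theorem finite_setOf_add_smul_mem {x y : E} {L : Submodule k E} (hx : x ∉ L) :
    {t : k | x + t • y ∈ L}.Finite := by
  refine Set.Subsingleton.finite fun t ht s hs => ?_
  by_contra hts
  have hy : y ∈ L := by
    have h := L.sub_mem ht hs
    rw [add_sub_add_left_eq_sub, ← sub_smul] at h
    exact (L.smul_mem_iff (sub_ne_zero.2 hts)).1 h
  exact hx ((L.add_mem_iff_left (L.smul_mem t hy)).1 ht)

/-- Modulo a subspace `S` of codimension at least two, there are `|k|`-many lines avoiding
finitely many proper subspaces. -/
theorem exists_injective_sup_span_singleton [Infinite k] [FiniteDimensional k E]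
    (F : Finset (Submodule k E)) (hF : ⊤ ∉ F) (S : Submodule k E)
    (hS : Module.finrank k S + 2 ≤ Module.finrank k E) :
    ∃ g : k → E, (∀ a, g a ∉ S ∧ ∀ L ∈ F, g a ∉ L) ∧
      Function.Injective fun a => S ⊔ Submodule.span k {g a} := by
  classical
  have hStop : S ≠ ⊤ := by
    rintro rfl
    rw [finrank_top] at hS
    omega
  obtain ⟨x, hx⟩ := exists_notMem_of_top_notMem (insert S F) (by
    simpa [eq_comm] using And.intro hStop.symm hF)
  have hxS : x ∉ S := hx S (Finset.mem_insert_self S F)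
  obtain ⟨y, hy⟩ : ∃ y, y ∉ S ⊔ Submodule.span k {x} := by
    by_contra! h
    have htop : S ⊔ Submodule.span k {x} = ⊤ := eq_top_iff.2 fun y _ => h y
    have := Submodule.finrank_sup_span_singleton hxS
    rw [htop, finrank_top] at this
    omega
  let B : Set k := ⋃ L ∈ insert S F, {t : k | x + t • y ∈ L}
  have hB : B.Finite := Set.Finite.biUnion (Finset.finite_toSet _) fun L hL =>
    finite_setOf_add_smul_mem (hx L hL)
  obtain ⟨e⟩ : Nonempty (k ≃ (Bᶜ : Set k)) := by
    refine Cardinal.eq.1 (Cardinal.mk_compl_of_infinite B ?_).symm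
    exact (Cardinal.lt_aleph0_iff_set_finite.2 hB).trans_le (Cardinal.aleph0_le_mk k)
  have he : ∀ a, ∀ L ∈ insert S F, x + (e a : k) • y ∉ L := fun a L hL h =>
    (e a).2 (Set.mem_biUnion hL h)
  refine ⟨fun a => x + (e a : k) • y, fun a => ⟨he a S (Finset.mem_insert_self S F),
    fun L hL => he a L (Finset.mem_insert_of_mem hL)⟩, fun a b hab => ?_⟩
  have hmem : x + (e a : k) • y ∈ S ⊔ Submodule.span k {x + (e b : k) • y} := by
    have hab' : S ⊔ Submodule.span k {x + (e a : k) • y} =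
      S ⊔ Submodule.span k {x + (e b : k) • y} := hab
    rw [← hab']
    exact Submodule.mem_sup_right (Submodule.mem_span_singleton_self _)
  obtain ⟨s, hs, z, hz, hsz⟩ := Submodule.mem_sup.1 hmem
  obtain ⟨c, rfl⟩ := Submodule.mem_span_singleton.1 hz
  have hcoeff : (e a : k) = c * (e b : k) := by
    by_contra hne
    refine hy (((S ⊔ Submodule.span k {x}).smul_mem_iff (sub_ne_zero.2 hne)).1 ?_)
    have : ((e a : k) - c * (e b : k)) • y = s + (c - 1) • x := by
      rw [eq_sub_of_add_eq hsz]
      module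
    rw [this]
    exact Submodule.add_mem_sup hs
      (Submodule.smul_mem _ _ (Submodule.mem_span_singleton_self x))
  have hc : c = 1 := by
    by_contra hne
    refine hxS ((S.smul_mem_iff (sub_ne_zero.2 (Ne.symm hne))).1 ?_)
    have : (1 - c) • x = s := by
      rw [eq_sub_of_add_eq hsz, hcoeff]
      module
    rwa [this]
  rw [hc, one_mul] at hcoeff
  exact e.injective (Subtype.ext hcoeff)

end Pencil

namespace MvPolynomial

variable {k σ : Type*} [Field k]

theorem isMaximal_of_forall_X_mem {p : Ideal (MvPolynomial σ k)} [p.IsPrime]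
    (h : ∀ i, X i ∈ p) : p.IsMaximal := by
  have hker : (RingHom.ker (constantCoeff : MvPolynomial σ k →+* k)).IsMaximal :=
    RingHom.ker_isMaximal_of_surjective _ fun a => ⟨C a, by simp⟩
  have hle : RingHom.ker (constantCoeff : MvPolynomial σ k →+* k) ≤ p := by
    intro f hf
    have hvars : idealOfVars σ k ≤ p := Ideal.span_le.2 (by rintro _ ⟨i, rfl⟩; exact h i)
    refine hvars ?_
    rw [← pow_one (idealOfVars σ k), mem_pow_idealOfVars_iff']
    intro x hx
    rw [Nat.lt_one_iff, Finsupp.degree_eq_zero_iff] at hx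
    subst hx
    exact hf
  rwa [← hker.eq_of_le (Ideal.IsPrime.ne_top ‹_›) hle]

theorem eval_zero_eq_zero_of_isHomogeneous {J : Ideal (MvPolynomial σ k)}
    (hJ : J.IsHomogeneous (homogeneousSubmodule σ k)) (htop : J ≠ ⊤) :
    ∀ f ∈ J, eval (0 : σ → k) f = 0 := by
  intro f hf
  have hC := homogeneousComponent_mem_of_mem hJ hf 0
  rw [homogeneousComponent_zero] at hC
  rw [eval_zero, constantCoeff_eq]
  by_contra h
  exact htop (Ideal.eq_top_of_isUnit_mem J hC ((isUnit_iff_ne_zero.2 h).map C))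

variable [Fintype σ]

/-- The linear form with the same values as a given functional on `σ → k`. -/
noncomputable def ofDual [DecidableEq σ] : Module.Dual k (σ → k) →ₗ[k] MvPolynomial σ k where
  toFun l := ∑ i, l (Pi.single i 1) • X i
  map_add' l m := by simp [add_smul, Finset.sum_add_distrib]
  map_smul' c l := by simp [mul_smul, Finset.smul_sum]

theorem ofDual_proj [DecidableEq σ] (i : σ) :
    ofDual (LinearMap.proj i : Module.Dual k (σ → k)) = X i := by
  simp [ofDual, Pi.single_apply]

theorem aeval_C_mul_X_ofDual [DecidableEq σ] (v : σ → k) (l : Module.Dual k (σ → k)) :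
    aeval (fun i => Polynomial.C (v i) * Polynomial.X) (ofDual l) =
      Polynomial.C (l v) * Polynomial.X := by
  have hl : l v = ∑ i, l (Pi.single i 1) * v i := by
    conv_lhs => rw [pi_eq_sum_univ' v]
    simp [mul_comm]
  simp [ofDual, hl, Finset.sum_mul, Polynomial.smul_eq_C_mul, mul_assoc]

/-- A general linear form lies in no non-maximal minimal prime of a given ideal. -/
theorem exists_finset_submodule_ofDual_notMem [DecidableEq σ] (I : Ideal (MvPolynomial σ k)) :
    ∃ F : Finset (Submodule k (Module.Dual k (σ → k))), ⊤ ∉ F ∧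
      ∀ l, (∀ L ∈ F, l ∉ L) → ∀ p ∈ I.minimalPrimes, ¬ p.IsMaximal → ofDual l ∉ p := by
  have hfin := (I.finite_minimalPrimes_of_isNoetherianRing).inter_of_left {p | ¬ p.IsMaximal}
  let L (p : Ideal (MvPolynomial σ k)) : Submodule k (Module.Dual k (σ → k)) :=
    (p.restrictScalars k).comap ofDual
  refine ⟨(hfin.image L).toFinset, ?_, fun l hl p hp hmax hmem => ?_⟩
  · simp only [Set.Finite.mem_toFinset]
    rintro ⟨p, ⟨hp, hmax⟩, htop⟩
    have := hp.1.1
    refine hmax (isMaximal_of_forall_X_mem fun i => ?_)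
    have hi : LinearMap.proj i ∈ L p := htop ▸ Submodule.mem_top
    rw [← ofDual_proj i]
    exact hi
  · refine hl (L p) ?_ hmem
    rw [Set.Finite.mem_toFinset]
    exact ⟨p, ⟨hp, hmax⟩, rfl⟩

theorem aeval_C_mul_X_of_isHomogeneous {f : MvPolynomial σ k} {d : ℕ} (hf : f.IsHomogeneous d)
    (v : σ → k) : aeval (fun i => Polynomial.C (v i) * Polynomial.X) f =
      Polynomial.C (eval v f) * Polynomial.X ^ d := by
  rw [aeval_def, eval₂_eq', eval_eq', map_sum, Finset.sum_mul]
  refine Finset.sum_congr rfl fun m hm => ?_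
  have hdeg : ∑ i, m i = d := by
    rw [← Finsupp.degree_eq_sum, Finsupp.degree_eq_weight_one]
    exact hf (mem_support_iff.1 hm)
  simp only [mul_pow, Finset.prod_mul_distrib, Finset.prod_pow_eq_pow_sum, hdeg]
  simp [mul_assoc]

theorem aeval_C_mul_X_eq_zero {J : Ideal (MvPolynomial σ k)}
    (hJ : J.IsHomogeneous (homogeneousSubmodule σ k)) {v : σ → k}
    (hv : ∀ f ∈ J, eval v f = 0) {f : MvPolynomial σ k} (hf : f ∈ J) :
    aeval (fun i => Polynomial.C (v i) * (Polynomial.X : Polynomial k)) f = 0 := by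
  rw [← sum_homogeneousComponent f, map_sum]
  refine Finset.sum_eq_zero fun d _ => ?_
  rw [aeval_C_mul_X_of_isHomogeneous (homogeneousComponent_isHomogeneous d f),
    hv _ (homogeneousComponent_mem_of_mem hJ hf d), map_zero, zero_mul]

/-- The ideal cutting out the intersection of the zero set of `J` with the common kernel of the
functionals in `S`. -/
noncomputable def sectionIdeal [DecidableEq σ] (J : Ideal (MvPolynomial σ k))
    (S : Submodule k (Module.Dual k (σ → k))) : Ideal (MvPolynomial σ k) :=
  J ⊔ Ideal.span (ofDual '' S)

theorem sectionIdeal_sup_span_singleton_le [DecidableEq σ] (J : Ideal (MvPolynomial σ k))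
    (S : Submodule k (Module.Dual k (σ → k))) (l : Module.Dual k (σ → k)) :
    sectionIdeal J S ⊔ Ideal.span {ofDual l} ≤ sectionIdeal J (S ⊔ Submodule.span k {l}) := by
  refine sup_le (sup_le_sup_left (Ideal.span_mono (Set.image_mono ?_)) _) ?_
  · exact_mod_cast (le_sup_left : S ≤ S ⊔ Submodule.span k {l})
  · rw [Ideal.span_singleton_le_iff_mem]
    exact Ideal.mem_sup_right (Ideal.subset_span ⟨l,
      Submodule.mem_sup_right (Submodule.mem_span_singleton_self l), rfl⟩)

theorem eq_zero_of_krullDim_sectionIdeal_le_zero [DecidableEq σ] {J : Ideal (MvPolynomial σ k)}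
    (hJ : J.IsHomogeneous (homogeneousSubmodule σ k)) {S : Submodule k (Module.Dual k (σ → k))}
    (hdim : Order.krullDim (PrimeSpectrum.zeroLocus (sectionIdeal J S : Set (MvPolynomial σ k))) ≤ 0)
    {v : σ → k} (hvS : v ∈ S.dualCoannihilator) (hvJ : ∀ f ∈ J, eval v f = 0) : v = 0 := by
  by_contra hv
  obtain ⟨i, hi⟩ := Function.ne_iff.1 hv
  let φ : MvPolynomial σ k →ₐ[k] Polynomial k :=
    aeval fun i => Polynomial.C (v i) * Polynomial.X
  let ψ : MvPolynomial σ k →+* k := (Polynomial.evalRingHom 0).comp φ.toRingHom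
  have hle : sectionIdeal J S ≤ RingHom.ker φ.toRingHom := by
    refine sup_le (fun f hf => aeval_C_mul_X_eq_zero hJ hvJ hf) (Ideal.span_le.2 ?_)
    rintro _ ⟨l, hl, rfl⟩
    refine (aeval_C_mul_X_ofDual v l).trans ?_
    rw [(Submodule.mem_dualCoannihilator v).1 hvS l hl, map_zero, zero_mul]
  have hφψ : RingHom.ker φ.toRingHom ≤ RingHom.ker ψ := fun f hf => by
    rw [RingHom.mem_ker] at hf ⊢
    rw [RingHom.comp_apply, hf, map_zero]
  have hlt : RingHom.ker φ.toRingHom < RingHom.ker ψ := by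
    refine lt_of_le_of_ne hφψ fun h => ?_
    have hX : (X i : MvPolynomial σ k) ∈ RingHom.ker φ.toRingHom := by
      rw [h, RingHom.mem_ker]
      simp [ψ, φ]
    rw [RingHom.mem_ker] at hX
    exact hi (by simpa [φ] using hX)
  let P : PrimeSpectrum.zeroLocus (sectionIdeal J S : Set (MvPolynomial σ k)) :=
    ⟨⟨RingHom.ker φ.toRingHom, RingHom.ker_isPrime _⟩, hle⟩
  let Q : PrimeSpectrum.zeroLocus (sectionIdeal J S : Set (MvPolynomial σ k)) :=
    ⟨⟨RingHom.ker ψ, RingHom.ker_isPrime _⟩, hle.trans hφψ⟩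
  have hPQ : P < Q := hlt
  have hone := (Order.one_le_krullDim_iff.2 ⟨P, Q, hPQ⟩).trans hdim
  norm_num at hone

/-- Cutting with `|k|`-many general linear forms, each of which lowers the dimension. -/
theorem exists_injective_krullDim_sectionIdeal_le [DecidableEq σ] [Infinite k]
    (J : Ideal (MvPolynomial σ k)) (S : Submodule k (Module.Dual k (σ → k))) (d : ℕ)
    (hS : Module.finrank k S + 2 ≤ Fintype.card σ)
    (hdim : Order.krullDim (PrimeSpectrum.zeroLocus (sectionIdeal J S : Set (MvPolynomial σ k))) ≤
      (d + 1 : ℕ)) :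
    ∃ g : k → Submodule k (Module.Dual k (σ → k)), Function.Injective g ∧
      ∀ a, Module.finrank k (g a) = Module.finrank k S + 1 ∧
        Order.krullDim (PrimeSpectrum.zeroLocus (sectionIdeal J (g a) : Set (MvPolynomial σ k))) ≤
          d := by
  obtain ⟨F, hF, hFp⟩ := exists_finset_submodule_ofDual_notMem (sectionIdeal J S)
  obtain ⟨g, hg, hinj⟩ := exists_injective_sup_span_singleton F hF S (by
    rwa [Subspace.dual_finrank_eq, Module.finrank_fintype_fun_eq_card])
  refine ⟨_, hinj, fun a => ⟨Submodule.finrank_sup_span_singleton (hg a).1, ?_⟩⟩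
  refine le_trans ?_ (krullDim_zeroLocus_sup_span_singleton_le _ _ d (hFp _ (hg a).2) hdim)
  exact Order.krullDim_le_of_strictMono (Set.inclusion
    (PrimeSpectrum.zeroLocus_anti_mono_ideal (sectionIdeal_sup_span_singleton_le J S (g a))))
    fun _ _ h => h

theorem exists_finrank_eq_krullDim_sectionIdeal_le [DecidableEq σ] [Infinite k]
    (J : Ideal (MvPolynomial σ k)) (d i : ℕ) (hi : i + 1 ≤ Fintype.card σ)
    (hdim : ringKrullDim (MvPolynomial σ k ⧸ J) ≤ (d + i : ℕ)) :
    ∃ S : Submodule k (Module.Dual k (σ → k)), Module.finrank k S = i ∧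
      Order.krullDim (PrimeSpectrum.zeroLocus (sectionIdeal J S : Set (MvPolynomial σ k))) ≤ d := by
  induction i generalizing d with
  | zero =>
    refine ⟨⊥, finrank_bot k _, ?_⟩
    have hbot : sectionIdeal J ⊥ = J := by simp [sectionIdeal]
    rwa [hbot, ← ringKrullDim_quotient]
  | succ i ih =>
    obtain ⟨S, hS, hSdim⟩ := ih (d + 1) (by omega) (by rwa [add_right_comm])
    obtain ⟨g, -, hg⟩ := exists_injective_krullDim_sectionIdeal_le J S d (by omega) hSdim
    exact ⟨g 0, by rw [(hg 0).1, hS], (hg 0).2⟩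

end MvPolynomial

/-- Theorem 17.1 (appendix): if `k` is algebraically closed, `n ≥ r + 2`, and `X ⊆ ℙⁿ(k)`
is a closed subvariety of dimension `r`, given by a homogeneous ideal `J` of
`k[X₀,…,Xₙ]` with `dim k[X₀,…,Xₙ]/J = r + 1` and affine cone `Z ⊆ k^{n+1}`, then there
are `|k|`-many distinct lines of `ℙⁿ(k)` disjoint from `X`: there is an injection from `k`
into the set of 2-dimensional linear subspaces `W ⊆ k^{n+1}` with `W ∩ Z = {0}`. -/
theorem exists_many_lines_disjoint_from_projective_variety
    (k : Type u) [Field k] [IsAlgClosed k]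
    (n r : ℕ) (hnr : r + 2 ≤ n)
    (J : Ideal (MvPolynomial (Fin (n + 1)) k))
    (hJhom : Ideal.IsHomogeneous (MvPolynomial.homogeneousSubmodule (Fin (n + 1)) k) J)
    (hJdim : ringKrullDim (MvPolynomial (Fin (n + 1)) k ⧸ J) = (r + 1 : ℕ)) :
    ∃ g : k → Submodule k (Fin (n + 1) → k),
      Function.Injective g ∧
        ∀ a : k, Module.finrank k (g a) = 2 ∧
          (g a : Set (Fin (n + 1) → k)) ∩
              {v : Fin (n + 1) → k | ∀ f ∈ J, MvPolynomial.eval v f = 0} = {0} := by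
  have : Infinite k := IsAlgClosed.instInfinite
  obtain ⟨S, hS, hSdim⟩ := MvPolynomial.exists_finrank_eq_krullDim_sectionIdeal_le J 1 (n - 2)
    (by rw [Fintype.card_fin]; omega) (by
      rw [hJdim]
      exact_mod_cast (by omega : r + 1 ≤ 1 + (n - 2)))
  obtain ⟨g, hinj, hg⟩ := MvPolynomial.exists_injective_krullDim_sectionIdeal_le J S 0
    (by rw [Fintype.card_fin]; omega) hSdim
  refine ⟨fun a => (g a).dualCoannihilator, fun a b hab => hinj ?_, fun a => ⟨?_, ?_⟩⟩
  · have h := congrArg Submodule.dualAnnihilator hab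
    simpa only [Subspace.dualCoannihilator_dualAnnihilator_eq] using h
  · have h := Subspace.finrank_add_finrank_dualCoannihilator_eq (g a)
    rw [(hg a).1, hS, Module.finrank_fintype_fun_eq_card, Fintype.card_fin] at h
    change Module.finrank k (g a).dualCoannihilator = 2
    omega
  · refine Set.Subset.antisymm (fun v hv => ?_) (Set.singleton_subset_iff.2 ⟨zero_mem _, ?_⟩)
    · exact MvPolynomial.eq_zero_of_krullDim_sectionIdeal_le_zero hJhom (hg a).2 hv.1 hv.2
    · exact MvPolynomial.eval_zero_eq_zero_of_isHomogeneous hJhom fun htop => by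
        have := Ideal.Quotient.subsingleton_iff.2 htop
        rw [ringKrullDim_eq_bot_of_subsingleton] at hJdim
        exact WithBot.bot_ne_natCast _ hJdim
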